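/- (Discrepancy property, Lemma 2.2.) There are absolute constants C, C′, c > 0 such that the following holds. Assume 1 ≤ d ≤ n/2, let δ ∈ (0,1), and suppose n₀ is an integer with (C/δ)·n·d^{−1/2} ≤ n₀ ≤ n. Then for a uniform random element A of 𝒜_{n,d}, P(A ∉ 𝒜^edge(n₀,δ)) ≤ n^{C′} · exp(−c δ min(d, δn)). -/

import Mathlib

open Filter Matrix
open scoped BigOperators

noncomputable section

/-- `𝒜_{n,d}`: the set of `n × n` matrices with entries in `{0,1}` all of whose row sums and
column sums equal `d` (viewed as real matrices). -/
def regSetR (n d : ℕ) : Set (Matrix (Fin n) (Fin n) ℝ) :=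
  {A | (∀ i j, A i j = 0 ∨ A i j = 1) ∧
       (∀ i, ∑ j, A i j = d) ∧ (∀ j, ∑ i, A i j = d)}

/-- The probability of the event `E` when a matrix is drawn uniformly at random from
`𝒜_{n,d}`. -/
def uniformProbR (n d : ℕ) (E : Set (Matrix (Fin n) (Fin n) ℝ)) : ℝ :=
  ((regSetR n d ∩ E).ncard : ℝ) / ((regSetR n d).ncard : ℝ)

/-- `e_A(I, J) = Σ_{i ∈ I, j ∈ J} A i j`, the number of directed edges from `I` to `J`. -/
def edgeCount {n : ℕ} (A : Matrix (Fin n) (Fin n) ℝ) (I J : Finset (Fin n)) : ℝ :=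
  ∑ i ∈ I, ∑ j ∈ J, A i j

/-- The discrepancy property defining `𝒜^edge(n₀, δ)`: for all `I, J ⊆ [n]` with
`|I|, |J| > n₀`, the edge count `e_A(I,J)` is within a factor `(1 ± δ)` of `(d/n)|I||J|`. -/
def edgeProp (n d : ℕ) (n₀ : ℕ) (δ : ℝ) : Set (Matrix (Fin n) (Fin n) ℝ) :=
  {A | ∀ I J : Finset (Fin n), n₀ < I.card → n₀ < J.card →
      |edgeCount A I J - (d : ℝ) / n * I.card * J.card| < δ * ((d : ℝ) / n) * I.card * J.card}

/-- `𝒜_{n,d}` is finite, as its elements are `0/1` matrices. -/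
lemma regSetR_finite (n d : ℕ) : (regSetR n d).Finite := by
  have h : (Set.pi Set.univ fun _ : Fin n => Set.pi Set.univ fun _ : Fin n =>
      ({0, 1} : Set ℝ)).Finite :=
    Set.Finite.pi fun _ => Set.Finite.pi fun _ => Set.toFinite _
  refine h.subset fun A hA => ?_
  intro i _ j _
  simpa using hA.1 i j

/-- A Chernoff bound for the uniform measure on a finite set, from a differential inequality
for the moment generating function. -/
lemma card_filter_le_of_mgf {α : Type*} (S : Finset α) (g : α → ℝ) (μ δ : ℝ) (hδ0 : 0 ≤ δ)
    (hδ1 : δ ≤ 1)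
    (h : ∀ θ : ℝ, 0 ≤ θ → θ ≤ 1 →
      ∑ a ∈ S, g a * Real.exp (θ * g a) ≤ 2 * μ * θ * ∑ a ∈ S, Real.exp (θ * g a)) :
    ((S.filter fun a => δ * μ ≤ g a).card : ℝ) ≤ S.card * Real.exp (-(δ ^ 2 * μ / 4)) := by
  set Φ : ℝ → ℝ := fun θ => Real.exp (-(μ * θ ^ 2)) * ∑ a ∈ S, Real.exp (θ * g a) with hΦ
  have hder : ∀ θ : ℝ, HasDerivAt Φ
      (Real.exp (-(μ * θ ^ 2)) * (∑ a ∈ S, g a * Real.exp (θ * g a) -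
        2 * μ * θ * ∑ a ∈ S, Real.exp (θ * g a))) θ := by
    intro θ
    have h1 : HasDerivAt (fun θ : ℝ => Real.exp (-(μ * θ ^ 2)))
        (Real.exp (-(μ * θ ^ 2)) * (-(μ * (2 * θ)))) θ := by
      have := ((hasDerivAt_pow 2 θ).const_mul μ).neg.exp
      simpa using this
    have h2 : HasDerivAt (fun θ : ℝ => ∑ a ∈ S, Real.exp (θ * g a))
        (∑ a ∈ S, g a * Real.exp (θ * g a)) θ := by
      refine HasDerivAt.fun_sum fun a _ => ?_
      have := ((hasDerivAt_id θ).mul_const (g a)).exp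
      simpa [mul_comm] using this
    refine (h1.mul h2).congr_deriv ?_
    ring
  have hanti : AntitoneOn Φ (Set.Icc 0 1) := by
    refine antitoneOn_of_deriv_nonpos (convex_Icc 0 1)
      (fun θ _ => (hder θ).continuousAt.continuousWithinAt)
      (fun θ _ => (hder θ).differentiableAt.differentiableWithinAt) ?_
    intro θ hθ
    rw [interior_Icc] at hθ
    rw [(hder θ).deriv]
    exact mul_nonpos_of_nonneg_of_nonpos (Real.exp_pos _).le
      (sub_nonpos.2 (h θ hθ.1.le hθ.2.le))
  have h0 : Φ (δ / 2) ≤ S.card := by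
    have := hanti (a := 0) (b := δ / 2) ⟨le_rfl, zero_le_one⟩ ⟨by linarith, by linarith⟩
      (by linarith)
    simpa [hΦ] using this
  have h1 : ((S.filter fun a => δ * μ ≤ g a).card : ℝ) * Real.exp (δ / 2 * (δ * μ)) ≤
      ∑ a ∈ S, Real.exp (δ / 2 * g a) := by
    rw [← nsmul_eq_mul, ← Finset.sum_const]
    refine (Finset.sum_le_sum fun a ha => ?_).trans (Finset.sum_le_sum_of_subset_of_nonneg
      (Finset.filter_subset (fun a => δ * μ ≤ g a) S) fun a _ _ => (Real.exp_pos _).le)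
    have := (Finset.mem_filter.1 ha).2
    gcongr
  calc ((S.filter fun a => δ * μ ≤ g a).card : ℝ)
      = (((S.filter fun a => δ * μ ≤ g a).card : ℝ) * Real.exp (δ / 2 * (δ * μ))) *
          Real.exp (-(δ / 2 * (δ * μ))) := by
        rw [mul_assoc, ← Real.exp_add]; simp
    _ ≤ (∑ a ∈ S, Real.exp (δ / 2 * g a)) * Real.exp (-(δ / 2 * (δ * μ))) := by gcongr
    _ = Φ (δ / 2) * Real.exp (-(δ ^ 2 * μ / 4)) := by
        rw [hΦ]
        simp only
        rw [mul_right_comm, ← Real.exp_add, mul_comm]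
        congr 2
        ring
    _ ≤ S.card * Real.exp (-(δ ^ 2 * μ / 4)) := by gcongr

/-- Exchange columns `j₁` and `j₂` in the rows `i₁` and `i₂` only. -/
def switch {n : ℕ} (i₁ i₂ j₁ j₂ : Fin n) (A : Matrix (Fin n) (Fin n) ℝ) :
    Matrix (Fin n) (Fin n) ℝ :=
  fun i j => A i (if i = i₁ ∨ i = i₂ then Equiv.swap j₁ j₂ j else j)

section Switch

variable {n d : ℕ} {i₁ i₂ j₁ j₂ : Fin n} {A : Matrix (Fin n) (Fin n) ℝ}

lemma switch_left (j : Fin n) : switch i₁ i₂ j₁ j₂ A i₁ j = A i₁ (Equiv.swap j₁ j₂ j) := by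
  simp [switch]

lemma switch_right (j : Fin n) : switch i₁ i₂ j₁ j₂ A i₂ j = A i₂ (Equiv.swap j₁ j₂ j) := by
  simp [switch]

lemma switch_of_ne {i : Fin n} (h₁ : i ≠ i₁) (h₂ : i ≠ i₂) (j : Fin n) :
    switch i₁ i₂ j₁ j₂ A i j = A i j := by
  simp [switch, h₁, h₂]

lemma switch_switch : switch i₁ i₂ j₁ j₂ (switch i₁ i₂ j₁ j₂ A) = A := by
  ext i j
  by_cases h : i = i₁ ∨ i = i₂ <;> simp [switch, h]

lemma switch_mem_regSetR (hi : i₁ ≠ i₂) (hA : A ∈ regSetR n d)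
    (hb : A i₁ j₁ + A i₂ j₁ = A i₁ j₂ + A i₂ j₂) : switch i₁ i₂ j₁ j₂ A ∈ regSetR n d := by
  refine ⟨fun i j => hA.1 _ _, fun i => ?_, fun j => ?_⟩
  · by_cases h : i = i₁ ∨ i = i₂
    · simp only [switch, h, if_true]
      rw [← hA.2.1 i]
      exact Equiv.sum_comp (Equiv.swap j₁ j₂) (A i)
    · simp only [switch, h, if_false]
      exact hA.2.1 i
  · rw [← hA.2.2 j]
    have hrow : ∀ i, switch i₁ i₂ j₁ j₂ A i j = A i j +
        ((if i = i₁ then A i₁ (Equiv.swap j₁ j₂ j) - A i₁ j else 0) +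
          (if i = i₂ then A i₂ (Equiv.swap j₁ j₂ j) - A i₂ j else 0)) := by
      intro i
      by_cases h₁ : i = i₁
      · subst h₁
        simp [switch_left, hi]
      · by_cases h₂ : i = i₂
        · subst h₂
          simp [switch_right, h₁]
        · simp [switch_of_ne h₁ h₂, h₁, h₂]
    simp only [hrow, Finset.sum_add_distrib, Finset.sum_ite_eq', Finset.mem_univ, if_true]
    by_cases h₁ : j = j₁
    · subst h₁
      simp only [Equiv.swap_apply_left]
      linarith
    · by_cases h₂ : j = j₂
      · subst h₂
        simp only [Equiv.swap_apply_right]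
        linarith
      · simp [Equiv.swap_apply_of_ne_of_ne h₁ h₂]

lemma edgeCount_switch {I J : Finset (Fin n)} (h₁ : i₁ ∈ I) (h₂ : i₂ ∉ I) (h₃ : j₁ ∈ J)
    (h₄ : j₂ ∉ J) :
    edgeCount (switch i₁ i₂ j₁ j₂ A) I J = edgeCount A I J - A i₁ j₁ + A i₁ j₂ := by
  unfold edgeCount
  rw [← Finset.add_sum_erase I _ h₁, ← Finset.add_sum_erase I _ h₁]
  have hrest : ∑ i ∈ I.erase i₁, ∑ j ∈ J, switch i₁ i₂ j₁ j₂ A i j =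
      ∑ i ∈ I.erase i₁, ∑ j ∈ J, A i j := by
    refine Finset.sum_congr rfl fun i hi => Finset.sum_congr rfl fun j _ => ?_
    obtain ⟨hi1, hi2⟩ := Finset.mem_erase.1 hi
    exact switch_of_ne hi1 (ne_of_mem_of_not_mem hi2 h₂) j
  have hrow : ∑ j ∈ J, switch i₁ i₂ j₁ j₂ A i₁ j = ∑ j ∈ J, A i₁ j - A i₁ j₁ + A i₁ j₂ := by
    rw [← Finset.add_sum_erase J _ h₃, ← Finset.add_sum_erase J (fun j => A i₁ j) h₃,
      switch_left, Equiv.swap_apply_left]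
    have : ∑ j ∈ J.erase j₁, switch i₁ i₂ j₁ j₂ A i₁ j = ∑ j ∈ J.erase j₁, A i₁ j := by
      refine Finset.sum_congr rfl fun j hj => ?_
      obtain ⟨hj1, hj2⟩ := Finset.mem_erase.1 hj
      rw [switch_left, Equiv.swap_apply_of_ne_of_ne hj1 (ne_of_mem_of_not_mem hj2 h₄)]
    rw [this]
    ring
  rw [hrest, hrow]
  ring

end Switch

/-- The number of columns in `J` in which row `i` has a one and row `k` has a zero. -/
def rowDiff {n : ℕ} (A : Matrix (Fin n) (Fin n) ℝ) (J : Finset (Fin n)) (i k : Fin n) : ℝ :=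
  ∑ j ∈ J, A i j * (1 - A k j)

/-- The indicator that rows `i, k` restricted to columns `j₁, j₂` form the identity pattern. -/
def switchable {n : ℕ} (A : Matrix (Fin n) (Fin n) ℝ) (i k j₁ j₂ : Fin n) : ℝ :=
  A i j₁ * (1 - A k j₁) * (A k j₂ * (1 - A i j₂))

/-- The total rate of switchings moving an edge from row `i` to row `k` inside `J`, each single
switching having rate the inverse of the size of the difference of the two rows. -/
def switchRate {n : ℕ} (A : Matrix (Fin n) (Fin n) ℝ) (J : Finset (Fin n)) (i k : Fin n) : ℝ :=
  rowDiff A J i k * rowDiff A Jᶜ k i / rowDiff A Finset.univ i k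

section Rates

variable {n d : ℕ} {A : Matrix (Fin n) (Fin n) ℝ}

lemma entry_nonneg (hA : A ∈ regSetR n d) (i j : Fin n) : 0 ≤ A i j := by
  rcases hA.1 i j with h | h <;> rw [h]
  exact zero_le_one

lemma entry_le_one (hA : A ∈ regSetR n d) (i j : Fin n) : A i j ≤ 1 := by
  rcases hA.1 i j with h | h <;> rw [h]
  exact zero_le_one

lemma rowDiff_nonneg (hA : A ∈ regSetR n d) (J : Finset (Fin n)) (i k : Fin n) :
    0 ≤ rowDiff A J i k :=
  Finset.sum_nonneg fun j _ =>
    mul_nonneg (entry_nonneg hA i j) (sub_nonneg.2 (entry_le_one hA k j))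

lemma rowDiff_add_compl (J : Finset (Fin n)) (i k : Fin n) :
    rowDiff A J i k + rowDiff A Jᶜ i k = rowDiff A Finset.univ i k :=
  Finset.sum_add_sum_compl J _

lemma rowDiff_sub_comm (J : Finset (Fin n)) (i k : Fin n) :
    rowDiff A J i k - rowDiff A J k i = ∑ j ∈ J, A i j - ∑ j ∈ J, A k j := by
  unfold rowDiff
  rw [← Finset.sum_sub_distrib, ← Finset.sum_sub_distrib]
  exact Finset.sum_congr rfl fun j _ => by ring

lemma rowDiff_univ_comm (hA : A ∈ regSetR n d) (i k : Fin n) :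
    rowDiff A Finset.univ i k = rowDiff A Finset.univ k i := by
  have := rowDiff_sub_comm (A := A) Finset.univ i k
  rw [hA.2.1 i, hA.2.1 k] at this
  linarith

lemma rowDiff_univ_switch {i₁ i₂ j₁ j₂ : Fin n} :
    rowDiff (switch i₁ i₂ j₁ j₂ A) Finset.univ i₁ i₂ = rowDiff A Finset.univ i₁ i₂ := by
  unfold rowDiff
  simp only [switch_left, switch_right]
  exact Equiv.sum_comp (Equiv.swap j₁ j₂) fun j => A i₁ j * (1 - A i₂ j)

lemma sum_switchable (J : Finset (Fin n)) (i k : Fin n) :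
    ∑ j₁ ∈ J, ∑ j₂ ∈ Jᶜ, switchable A i k j₁ j₂ = rowDiff A J i k * rowDiff A Jᶜ k i := by
  unfold rowDiff switchable
  rw [Finset.sum_mul_sum]

lemma switchRate_sub_comm (hA : A ∈ regSetR n d) (J : Finset (Fin n)) (i k : Fin n) :
    switchRate A J i k - switchRate A J k i = ∑ j ∈ J, A i j - ∑ j ∈ J, A k j := by
  rw [← rowDiff_sub_comm]
  have h1 := rowDiff_add_compl (A := A) J i k
  have h2 := rowDiff_add_compl (A := A) J k i
  have h3 := rowDiff_univ_comm hA i k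
  have p1 := rowDiff_nonneg hA J i k
  have p2 := rowDiff_nonneg hA J k i
  have p3 := rowDiff_nonneg hA Jᶜ i k
  have p4 := rowDiff_nonneg hA Jᶜ k i
  unfold switchRate
  rw [← h3]
  rcases eq_or_ne (rowDiff A Finset.univ i k) 0 with h0 | h0
  · rw [h0]
    simp only [div_zero]
    linarith
  · rw [← sub_div, div_eq_iff h0]
    have e1 : rowDiff A Jᶜ i k = rowDiff A Finset.univ i k - rowDiff A J i k := by linarith
    have e2 : rowDiff A Jᶜ k i = rowDiff A Finset.univ i k - rowDiff A J k i := by linarith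
    rw [e1, e2]
    ring

lemma switchRate_nonneg (hA : A ∈ regSetR n d) (J : Finset (Fin n)) (i k : Fin n) :
    0 ≤ switchRate A J i k :=
  div_nonneg (mul_nonneg (rowDiff_nonneg hA _ _ _) (rowDiff_nonneg hA _ _ _))
    (rowDiff_nonneg hA _ _ _)

lemma switchRate_le (hA : A ∈ regSetR n d) (J : Finset (Fin n)) (i k : Fin n) :
    switchRate A J i k ≤ ∑ j ∈ J, A i j := by
  have h1 : rowDiff A J i k ≤ ∑ j ∈ J, A i j := by
    refine Finset.sum_le_sum fun j _ => ?_
    nlinarith [mul_nonneg (entry_nonneg hA i j) (entry_nonneg hA k j)]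
  refine le_trans ?_ h1
  have h2 := rowDiff_add_compl (A := A) J k i
  have h3 := rowDiff_univ_comm hA i k
  have p2 := rowDiff_nonneg hA J k i
  refine div_le_of_le_mul₀ (rowDiff_nonneg hA _ _ _) (rowDiff_nonneg hA _ _ _) ?_
  exact mul_le_mul_of_nonneg_left (by linarith) (rowDiff_nonneg hA _ _ _)

lemma sum_sum_compl (hA : A ∈ regSetR n d) (I J : Finset (Fin n)) :
    ∑ i ∈ Iᶜ, ∑ j ∈ J, A i j = d * J.card - edgeCount A I J := by
  have h : ∑ i, ∑ j ∈ J, A i j = d * J.card := by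
    refine (Finset.sum_comm (f := fun i j => A i j)).trans ?_
    simp [hA.2.2, mul_comm]
  rw [← Finset.sum_add_sum_compl I] at h
  unfold edgeCount
  linarith

lemma sum_switchRate_sub (hn : n ≠ 0) (hA : A ∈ regSetR n d) (I J : Finset (Fin n)) :
    ∑ i ∈ I, ∑ k ∈ Iᶜ, switchRate A J i k - ∑ i ∈ I, ∑ k ∈ Iᶜ, switchRate A J k i =
      n * (edgeCount A I J - (d : ℝ) / n * I.card * J.card) := by
  simp only [← Finset.sum_sub_distrib, switchRate_sub_comm hA]
  simp only [Finset.sum_sub_distrib, Finset.sum_const, sum_sum_compl hA, nsmul_eq_mul,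
    ← Finset.mul_sum]
  have hc : ((Iᶜ.card : ℕ) : ℝ) = n - I.card := by
    rw [Finset.card_compl, Fintype.card_fin, Nat.cast_sub (by simpa using Finset.card_le_univ I)]
  rw [hc]
  have hn' : (n : ℝ) ≠ 0 := Nat.cast_ne_zero.2 hn
  change ((n : ℝ) - I.card) * edgeCount A I J - _ = _
  field_simp
  ring

lemma sum_switchRate_nonneg (hA : A ∈ regSetR n d) (I J : Finset (Fin n)) :
    0 ≤ ∑ i ∈ I, ∑ k ∈ Iᶜ, switchRate A J k i :=
  Finset.sum_nonneg fun _ _ => Finset.sum_nonneg fun _ _ => switchRate_nonneg hA _ _ _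

lemma sum_switchRate_le (hA : A ∈ regSetR n d) (I J : Finset (Fin n)) :
    ∑ i ∈ I, ∑ k ∈ Iᶜ, switchRate A J k i ≤ d * I.card * J.card := by
  have he : 0 ≤ edgeCount A I J :=
    Finset.sum_nonneg fun i _ => Finset.sum_nonneg fun j _ => entry_nonneg hA i j
  calc ∑ i ∈ I, ∑ k ∈ Iᶜ, switchRate A J k i
      ≤ ∑ i ∈ I, ∑ k ∈ Iᶜ, ∑ j ∈ J, A k j :=
        Finset.sum_le_sum fun i _ => Finset.sum_le_sum fun k _ => switchRate_le hA _ _ _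
    _ = I.card * (d * J.card - edgeCount A I J) := by
        rw [Finset.sum_const, sum_sum_compl hA, nsmul_eq_mul]
    _ ≤ d * I.card * J.card := by
        nlinarith [mul_nonneg (Nat.cast_nonneg (α := ℝ) I.card) he]

end Rates

/-- Reversibility of a single switching under the uniform measure on `𝒜_{n,d}`. -/
lemma sum_switchable_mul {n d : ℕ} {I J : Finset (Fin n)} {i k j₁ j₂ : Fin n} (hi : i ∈ I)
    (hk : k ∉ I) (h₁ : j₁ ∈ J) (h₂ : j₂ ∉ J) (h : ℝ → ℝ) :
    ∑ A ∈ (regSetR_finite n d).toFinset,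
        switchable A i k j₁ j₂ / rowDiff A Finset.univ i k * h (edgeCount A I J) =
      ∑ A ∈ (regSetR_finite n d).toFinset,
        switchable A k i j₁ j₂ / rowDiff A Finset.univ k i * h (edgeCount A I J + 1) := by
  classical
  have hik : i ≠ k := fun e => hk (e ▸ hi)
  set S := (regSetR_finite n d).toFinset with hS
  set p : Matrix (Fin n) (Fin n) ℝ → Prop := fun A => A i j₁ + A k j₁ = A i j₂ + A k j₂ with hp
  have hbal : ∀ A ∈ S, ¬ p A → switchable A i k j₁ j₂ = 0 ∧ switchable A k i j₁ j₂ = 0 := by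
    intro A hA hpA
    have hA' : A ∈ regSetR n d := by simpa [hS] using hA
    simp only [hp] at hpA
    unfold switchable
    rcases hA'.1 i j₁ with e1 | e1 <;> rcases hA'.1 i j₂ with e2 | e2 <;>
      rcases hA'.1 k j₁ with e3 | e3 <;> rcases hA'.1 k j₂ with e4 | e4 <;>
      simp [e1, e2, e3, e4] at hpA ⊢
  have hfil : ∀ F : Matrix (Fin n) (Fin n) ℝ → ℝ, (∀ A ∈ S, ¬ p A → F A = 0) →
      ∑ A ∈ S, F A = ∑ A ∈ S.filter p, F A := by
    intro F hF
    rw [Finset.sum_filter]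
    refine Finset.sum_congr rfl fun A hA => ?_
    split_ifs with hpA
    · rfl
    · exact hF A hA hpA
  rw [hfil _ fun A hA hpA => by rw [(hbal A hA hpA).1]; simp,
    hfil _ fun A hA hpA => by rw [(hbal A hA hpA).2]; simp]
  have hmaps : ∀ A ∈ S.filter p, switch i k j₁ j₂ A ∈ S.filter p := by
    intro A hA
    obtain ⟨hA, hpA⟩ := Finset.mem_filter.1 hA
    have hA' : A ∈ regSetR n d := by simpa [hS] using hA
    refine Finset.mem_filter.2 ⟨?_, ?_⟩
    · simpa [hS] using switch_mem_regSetR hik hA' hpA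
    · simp only [hp, switch_left, switch_right, Equiv.swap_apply_left, Equiv.swap_apply_right]
      exact hpA.symm
  refine Finset.sum_nbij' (switch i k j₁ j₂) (switch i k j₁ j₂) hmaps hmaps
    (fun _ _ => switch_switch) (fun _ _ => switch_switch) ?_
  intro A hA
  obtain ⟨hA2, -⟩ := Finset.mem_filter.1 hA
  obtain ⟨hA3, -⟩ := Finset.mem_filter.1 (hmaps A hA)
  have hA' : A ∈ regSetR n d := by simpa [hS] using hA2
  have hB' : switch i k j₁ j₂ A ∈ regSetR n d := by simpa [hS] using hA3
  have hsw : switchable (switch i k j₁ j₂ A) k i j₁ j₂ = switchable A i k j₁ j₂ := by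
    simp only [switchable, switch_left, switch_right, Equiv.swap_apply_left,
      Equiv.swap_apply_right]
    ring
  rw [rowDiff_univ_comm hB' k i, rowDiff_univ_switch, hsw, edgeCount_switch hi hk h₁ h₂]
  rcases hA'.1 i j₁ with e1 | e1 <;> rcases hA'.1 i j₂ with e2 | e2 <;>
    simp [switchable, e1, e2]

lemma sum_switchRate_mul {n d : ℕ} (I J : Finset (Fin n)) (h : ℝ → ℝ) :
    ∑ A ∈ (regSetR_finite n d).toFinset,
        (∑ i ∈ I, ∑ k ∈ Iᶜ, switchRate A J i k) * h (edgeCount A I J) =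
      ∑ A ∈ (regSetR_finite n d).toFinset,
        (∑ i ∈ I, ∑ k ∈ Iᶜ, switchRate A J k i) * h (edgeCount A I J + 1) := by
  have hdown : ∀ (A : Matrix (Fin n) (Fin n) ℝ) (i k : Fin n), switchRate A J i k =
      ∑ j₁ ∈ J, ∑ j₂ ∈ Jᶜ, switchable A i k j₁ j₂ / rowDiff A Finset.univ i k := by
    intro A i k
    simp only [← Finset.sum_div, sum_switchable]
    rfl
  simp only [hdown, Finset.sum_mul]
  rw [Finset.sum_comm]
  conv_rhs => rw [Finset.sum_comm]
  refine Finset.sum_congr rfl fun i hi => ?_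
  rw [Finset.sum_comm]
  conv_rhs => rw [Finset.sum_comm]
  refine Finset.sum_congr rfl fun k hk => ?_
  rw [Finset.sum_comm]
  conv_rhs => rw [Finset.sum_comm]
  refine Finset.sum_congr rfl fun j₁ hj₁ => ?_
  rw [Finset.sum_comm]
  conv_rhs => rw [Finset.sum_comm]
  refine Finset.sum_congr rfl fun j₂ hj₂ => ?_
  exact sum_switchable_mul hi (Finset.mem_compl.1 hk) hj₁ (Finset.mem_compl.1 hj₂) h

/-- The moment generating function of the centred edge count satisfies
`|Z'(θ)| ≤ μ |e^θ - 1| Z(θ)`. -/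
lemma abs_sum_mul_exp_le {n d : ℕ} (hn : n ≠ 0) (I J : Finset (Fin n)) (μ θ : ℝ)
    (hμ : μ = (d : ℝ) / n * I.card * J.card) :
    |∑ A ∈ (regSetR_finite n d).toFinset,
        (edgeCount A I J - μ) * Real.exp (θ * (edgeCount A I J - μ))| ≤
      μ * |Real.exp θ - 1| *
        ∑ A ∈ (regSetR_finite n d).toFinset, Real.exp (θ * (edgeCount A I J - μ)) := by
  set S := (regSetR_finite n d).toFinset with hS
  have hn' : (0 : ℝ) < n := Nat.cast_pos.2 (Nat.pos_of_ne_zero hn)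
  have hμn : n * μ = d * I.card * J.card := by
    rw [hμ]
    field_simp
  have hmem : ∀ A ∈ S, A ∈ regSetR n d := fun A hA => by simpa [hS] using hA
  have hrev := sum_switchRate_mul (d := d) I J fun x => Real.exp (θ * (x - μ))
  have key : n * ∑ A ∈ S, (edgeCount A I J - μ) * Real.exp (θ * (edgeCount A I J - μ)) =
      (Real.exp θ - 1) * ∑ A ∈ S, (∑ i ∈ I, ∑ k ∈ Iᶜ, switchRate A J k i) *
        Real.exp (θ * (edgeCount A I J - μ)) := by
    rw [Finset.mul_sum]
    calc ∑ A ∈ S, n * ((edgeCount A I J - μ) * Real.exp (θ * (edgeCount A I J - μ)))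
        = ∑ A ∈ S, ((∑ i ∈ I, ∑ k ∈ Iᶜ, switchRate A J i k) *
              Real.exp (θ * (edgeCount A I J - μ)) -
            (∑ i ∈ I, ∑ k ∈ Iᶜ, switchRate A J k i) *
              Real.exp (θ * (edgeCount A I J - μ))) := by
          refine Finset.sum_congr rfl fun A hA => ?_
          rw [← sub_mul, sum_switchRate_sub hn (hmem A hA), hμ]
          ring
      _ = _ := by
          rw [Finset.sum_sub_distrib, hrev, ← Finset.sum_sub_distrib, Finset.mul_sum]
          refine Finset.sum_congr rfl fun A _ => ?_
          rw [show θ * (edgeCount A I J + 1 - μ) = θ + θ * (edgeCount A I J - μ) by ring,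
            Real.exp_add]
          ring
  have hU0 : 0 ≤ ∑ A ∈ S, (∑ i ∈ I, ∑ k ∈ Iᶜ, switchRate A J k i) *
      Real.exp (θ * (edgeCount A I J - μ)) :=
    Finset.sum_nonneg fun A hA =>
      mul_nonneg (sum_switchRate_nonneg (hmem A hA) I J) (Real.exp_pos _).le
  have hU1 : ∑ A ∈ S, (∑ i ∈ I, ∑ k ∈ Iᶜ, switchRate A J k i) *
      Real.exp (θ * (edgeCount A I J - μ)) ≤
        n * μ * ∑ A ∈ S, Real.exp (θ * (edgeCount A I J - μ)) := by
    rw [Finset.mul_sum, hμn]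
    exact Finset.sum_le_sum fun A hA =>
      mul_le_mul_of_nonneg_right (sum_switchRate_le (hmem A hA) I J) (Real.exp_pos _).le
  refine le_of_mul_le_mul_left ?_ hn'
  calc n * |∑ A ∈ S, (edgeCount A I J - μ) * Real.exp (θ * (edgeCount A I J - μ))|
      = |n * ∑ A ∈ S, (edgeCount A I J - μ) * Real.exp (θ * (edgeCount A I J - μ))| := by
        rw [abs_mul, abs_of_pos hn']
    _ = |Real.exp θ - 1| * ∑ A ∈ S, (∑ i ∈ I, ∑ k ∈ Iᶜ, switchRate A J k i) *
          Real.exp (θ * (edgeCount A I J - μ)) := by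
        rw [key, abs_mul, abs_of_nonneg hU0]
    _ ≤ |Real.exp θ - 1| * (n * μ * ∑ A ∈ S, Real.exp (θ * (edgeCount A I J - μ))) := by
        gcongr
    _ = _ := by ring

/-- Concentration of a single edge count over the uniform measure on `𝒜_{n,d}`. -/
lemma card_edgeCount_deviation_le {n d : ℕ} (hn : n ≠ 0) (I J : Finset (Fin n)) (μ δ : ℝ)
    (hμ : μ = (d : ℝ) / n * I.card * J.card) (hδ0 : 0 ≤ δ) (hδ1 : δ ≤ 1) :
    (((regSetR_finite n d).toFinset.filter
        fun A => δ * μ ≤ |edgeCount A I J - μ|).card : ℝ) ≤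
      2 * ((regSetR_finite n d).toFinset.card * Real.exp (-(δ ^ 2 * μ / 4))) := by
  classical
  set S := (regSetR_finite n d).toFinset with hS
  have hμ0 : 0 ≤ μ := by rw [hμ]; positivity
  have hZ : ∀ θ : ℝ, 0 ≤ ∑ A ∈ S, Real.exp (θ * (edgeCount A I J - μ)) := fun θ =>
    Finset.sum_nonneg fun A _ => (Real.exp_pos _).le
  have hexp : ∀ θ : ℝ, |θ| ≤ 1 → μ * |Real.exp θ - 1| ≤ 2 * μ * |θ| := fun θ hθ => by
    nlinarith [mul_le_mul_of_nonneg_left (Real.abs_exp_sub_one_le hθ) hμ0]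
  have hup := card_filter_le_of_mgf S (fun A => edgeCount A I J - μ) μ δ hδ0 hδ1 (by
    intro θ h0 h1
    refine (le_abs_self _).trans ((abs_sum_mul_exp_le hn I J μ θ hμ).trans ?_)
    have := hexp θ (by rwa [abs_of_nonneg h0])
    rw [abs_of_nonneg h0] at this
    exact mul_le_mul_of_nonneg_right this (hZ θ))
  have hlo := card_filter_le_of_mgf S (fun A => -(edgeCount A I J - μ)) μ δ hδ0 hδ1 (by
    intro θ h0 h1
    have h2 := abs_sum_mul_exp_le (d := d) hn I J μ (-θ) hμ
    have := hexp (-θ) (by rwa [abs_neg, abs_of_nonneg h0])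
    rw [abs_neg, abs_of_nonneg h0] at this
    have h3 := (neg_le_abs _).trans (h2.trans (mul_le_mul_of_nonneg_right this (hZ (-θ))))
    simpa only [← Finset.sum_neg_distrib, neg_mul, mul_neg] using h3)
  have hsub : (S.filter fun A => δ * μ ≤ |edgeCount A I J - μ|) ⊆
      (S.filter fun A => δ * μ ≤ edgeCount A I J - μ) ∪
        S.filter fun A => δ * μ ≤ -(edgeCount A I J - μ) := by
    intro A hA
    simp only [Finset.mem_union, Finset.mem_filter] at hA ⊢
    rcases le_abs.1 hA.2 with h | h
    · exact Or.inl ⟨hA.1, h⟩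
    · exact Or.inr ⟨hA.1, h⟩
  have hcard : ((S.filter fun A => δ * μ ≤ |edgeCount A I J - μ|).card : ℝ) ≤
      (S.filter fun A => δ * μ ≤ edgeCount A I J - μ).card +
        (S.filter fun A => δ * μ ≤ -(edgeCount A I J - μ)).card := by
    exact_mod_cast (Finset.card_le_card hsub).trans (Finset.card_union_le _ _)
  linarith

/-- The edge count fails the discrepancy property with exponentially small probability. -/
lemma uniformProbR_not_edgeProp_le {n d n₀ : ℕ} (hn : n ≠ 0) {δ : ℝ} (hδ0 : 0 ≤ δ)
    (hδ1 : δ ≤ 1) {m : ℝ} (hm : m ≤ δ ^ 2 * ((d : ℝ) / n * n₀ * n₀) / 4) :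
    uniformProbR n d {A | A ∉ edgeProp n d n₀ δ} ≤ 2 * 4 ^ n * Real.exp (-m) := by
  classical
  set S := (regSetR_finite n d).toFinset with hS
  set μ : Finset (Fin n) × Finset (Fin n) → ℝ := fun q => (d : ℝ) / n * q.1.card * q.2.card
    with hμ
  set P := (Finset.univ : Finset (Finset (Fin n) × Finset (Fin n))).filter
    fun q => n₀ < q.1.card ∧ n₀ < q.2.card with hP
  set B : Finset (Fin n) × Finset (Fin n) → Finset (Matrix (Fin n) (Fin n) ℝ) := fun q =>
    S.filter fun A => δ * μ q ≤ |edgeCount A q.1 q.2 - μ q| with hB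
  have hsub : regSetR n d ∩ {A | A ∉ edgeProp n d n₀ δ} ⊆ (P.biUnion B : Finset _) := by
    rintro A ⟨hA, hAe⟩
    simp only [edgeProp, Set.mem_ofPred_eq, not_forall, not_lt] at hAe
    obtain ⟨I, J, hI, hJ, h⟩ := hAe
    simp only [Finset.coe_biUnion, Set.mem_iUnion, Finset.mem_coe]
    refine ⟨(I, J), by simp [hP, hI, hJ], ?_⟩
    refine Finset.mem_filter.2 ⟨by simpa [hS] using hA, ?_⟩
    simpa only [hμ, ← mul_assoc] using h
  have hBle : ∀ q ∈ P, ((B q).card : ℝ) ≤ 2 * (S.card * Real.exp (-m)) := by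
    intro q hq
    obtain ⟨-, h1, h2⟩ := Finset.mem_filter.1 hq
    refine (card_edgeCount_deviation_le hn q.1 q.2 (μ q) δ rfl hδ0 hδ1).trans ?_
    have hle : (d : ℝ) / n * n₀ * n₀ ≤ μ q := by
      simp only [hμ]
      gcongr
    have : m ≤ δ ^ 2 * μ q / 4 := hm.trans (by gcongr)
    gcongr
  have hPcard : (P.card : ℝ) ≤ 4 ^ n := by
    have : P.card ≤ 4 ^ n := by
      refine (Finset.card_filter_le _ _).trans (le_of_eq ?_)
      rw [Finset.card_univ, Fintype.card_prod, Fintype.card_finset, Fintype.card_fin,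
        ← mul_pow]
      norm_num
    exact_mod_cast this
  have hnum : ((regSetR n d ∩ {A | A ∉ edgeProp n d n₀ δ}).ncard : ℝ) ≤
      2 * 4 ^ n * Real.exp (-m) * S.card := by
    calc ((regSetR n d ∩ {A | A ∉ edgeProp n d n₀ δ}).ncard : ℝ)
        ≤ (P.biUnion B).card := by
          have := Set.ncard_le_ncard hsub (Finset.finite_toSet _)
          rw [Set.ncard_coe_finset] at this
          exact_mod_cast this
      _ ≤ ∑ q ∈ P, ((B q).card : ℝ) := by exact_mod_cast Finset.card_biUnion_le
      _ ≤ ∑ _q ∈ P, 2 * (S.card * Real.exp (-m)) := Finset.sum_le_sum hBle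
      _ = P.card * (2 * (S.card * Real.exp (-m))) := by rw [Finset.sum_const, nsmul_eq_mul]
      _ ≤ 4 ^ n * (2 * (S.card * Real.exp (-m))) := by gcongr
      _ = _ := by ring
  unfold uniformProbR
  rw [Set.ncard_eq_toFinset_card _ (regSetR_finite n d)]
  exact div_le_of_le_mul₀ (Nat.cast_nonneg _) (by positivity) hnum

/-- **Discrepancy property** (Lemma 2.2): for `1 ≤ d ≤ n/2`, `δ ∈ (0,1)` and
`(C/δ) n d^{-1/2} ≤ n₀ ≤ n`, a uniform random `A ∈ 𝒜_{n,d}` fails the discrepancy property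
`𝒜^edge(n₀, δ)` with probability at most `n^{C'} exp(-cδ min(d, δn))`. -/
theorem discrepancy_property :
    ∃ C C' c : ℝ, 0 < C ∧ 0 < C' ∧ 0 < c ∧
      ∀ n d : ℕ, 1 ≤ d → 2 * d ≤ n →
        ∀ δ : ℝ, δ ∈ Set.Ioo (0 : ℝ) 1 →
          ∀ n₀ : ℕ, C / δ * n * (d : ℝ) ^ (-(1 / 2) : ℝ) ≤ n₀ → n₀ ≤ n →
            uniformProbR n d {A | A ∉ edgeProp n d n₀ δ} ≤
              (n : ℝ) ^ C' * Real.exp (-c * δ * min (d : ℝ) (δ * n)) := by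
  refine ⟨4, 1, 1, by norm_num, by norm_num, by norm_num, ?_⟩
  intro n d hd hdn δ hδ n₀ hn₀ _
  have hn2 : 2 ≤ n := by omega
  have hn : (2 : ℝ) ≤ n := by exact_mod_cast hn2
  have hd' : (0 : ℝ) < d := by exact_mod_cast hd
  have hm : 4 * (n : ℝ) ≤ δ ^ 2 * ((d : ℝ) / n * n₀ * n₀) / 4 := by
    have hpow : ((d : ℝ) ^ (-(1 / 2) : ℝ)) ^ 2 = (d : ℝ)⁻¹ := by
      rw [← Real.rpow_natCast, ← Real.rpow_mul hd'.le]
      norm_num [Real.rpow_neg_one]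
    have hpos : 0 ≤ 4 / δ * n * (d : ℝ) ^ (-(1 / 2) : ℝ) := by
      have := hδ.1
      positivity
    have hsq : 16 / δ ^ 2 * n ^ 2 * (d : ℝ)⁻¹ ≤ (n₀ : ℝ) ^ 2 := by
      have := pow_le_pow_left₀ hpos hn₀ 2
      rw [mul_pow, mul_pow, hpow, div_pow] at this
      norm_num at this ⊢
      exact this
    have hδ' : δ ≠ 0 := hδ.1.ne'
    have hn' : (n : ℝ) ≠ 0 := by linarith
    calc 4 * (n : ℝ) = δ ^ 2 * ((d : ℝ) / n * (16 / δ ^ 2 * n ^ 2 * (d : ℝ)⁻¹)) / 4 := by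
          field_simp
          norm_num
      _ ≤ δ ^ 2 * ((d : ℝ) / n * (n₀ : ℝ) ^ 2) / 4 := by gcongr
      _ = _ := by ring
  have hexp1 : (2 : ℝ) ≤ Real.exp 1 := by linarith [Real.add_one_le_exp (1 : ℝ)]
  have hexpn : (2 * 4 ^ n : ℝ) ≤ Real.exp (3 * n) := by
    calc (2 * 4 ^ n : ℝ) ≤ 2 ^ n * 4 ^ n := by
          gcongr
          exact le_self_pow₀ one_le_two (by omega)
      _ = (2 ^ 3) ^ n := by rw [← mul_pow]; norm_num
      _ ≤ (Real.exp 1 ^ 3) ^ n := by gcongr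
      _ = Real.exp (3 * n) := by
          rw [← pow_mul, ← Real.exp_nat_mul]
          push_cast
          ring_nf
  have hmin : δ * min (d : ℝ) (δ * n) ≤ n := by
    have h1 : min (d : ℝ) (δ * n) ≤ n :=
      (min_le_right _ _).trans (by nlinarith [hδ.2])
    have h2 : 0 ≤ min (d : ℝ) (δ * n) := le_min hd'.le (by nlinarith [hδ.1])
    nlinarith [hδ.1, hδ.2]
  calc uniformProbR n d {A | A ∉ edgeProp n d n₀ δ}
      ≤ 2 * 4 ^ n * Real.exp (-(4 * n)) :=
        uniformProbR_not_edgeProp_le (by omega) hδ.1.le hδ.2.le hm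
    _ ≤ Real.exp (3 * n) * Real.exp (-(4 * n)) := by gcongr
    _ = 1 * Real.exp (-n) := by
        rw [← Real.exp_add]
        ring_nf
    _ ≤ (n : ℝ) ^ (1 : ℝ) * Real.exp (-1 * δ * min (d : ℝ) (δ * n)) := by
        rw [Real.rpow_one]
        gcongr
        · linarith
        · linarith

end
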